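/- arXiv:1011.0851 — 6 statements merged into one kernel-verified Lean document; each statement's English description precedes it below -/
import Mathlib

section
/- Let p, q : ℝ → ℝ³ be differentiable trajectories with ‖p(t)‖ = ‖q(t)‖ = 1 for all t, such that p(t) ≠ q(t) and p(t) ≠ −q(t) for all t. Then for every t, d/dt [arccos(p(t)·q(t))] = −p′(t) · Y(p(t), q(t)) − q′(t) · Y(q(t), p(t)). -/
open Real

/-- Euclidean dot product on ℝ³. -/
def dot3 (a b : Fin 3 → ℝ) : ℝ := a 0 * b 0 + a 1 * b 1 + a 2 * b 2

/-- Euclidean norm on ℝ³. -/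
noncomputable def norm3 (a : Fin 3 → ℝ) : ℝ := Real.sqrt (dot3 a a)

/-- The geodesic vector pointing from the unit vector `x` towards the unit vector `y`:
`Y(x,y) = (y − (y·x)x)/‖y − (y·x)x‖`. -/
noncomputable def Yvec (x y : Fin 3 → ℝ) : Fin 3 → ℝ :=
  (norm3 (y - dot3 y x • x))⁻¹ • (y - dot3 y x • x)

theorem dot3_comm (a b : Fin 3 → ℝ) : dot3 a b = dot3 b a := by
  simp only [dot3]; ring

theorem dot3_self_nonneg (a : Fin 3 → ℝ) : 0 ≤ dot3 a a := by
  simp only [dot3]; nlinarith [mul_self_nonneg (a 0), mul_self_nonneg (a 1), mul_self_nonneg (a 2)]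

theorem dot3_self_eq_one_of_norm3_eq_one {a : Fin 3 → ℝ} (ha : norm3 a = 1) : dot3 a a = 1 :=
  Real.sqrt_eq_one.mp ha

theorem dot3_self_eq_zero {a : Fin 3 → ℝ} (ha : dot3 a a = 0) : a = 0 := by
  simp only [dot3] at ha
  funext i
  fin_cases i <;> refine mul_self_eq_zero.mp ?_ <;> dsimp only [Fin.isValue, Fin.reduceFinMk] <;>
    nlinarith [mul_self_nonneg (a 0), mul_self_nonneg (a 1), mul_self_nonneg (a 2)]

theorem dot3_lt_one {x y : Fin 3 → ℝ} (hx : dot3 x x = 1) (hy : dot3 y y = 1) (hne : x ≠ y) :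
    dot3 x y < 1 := by
  have hpos : 0 < dot3 (x - y) (x - y) :=
    (dot3_self_nonneg _).lt_of_ne' fun h => hne (sub_eq_zero.mp (dot3_self_eq_zero h))
  simp only [dot3, Pi.sub_apply] at *
  linarith

theorem neg_one_lt_dot3 {x y : Fin 3 → ℝ} (hx : dot3 x x = 1) (hy : dot3 y y = 1)
    (hne : x ≠ -y) : -1 < dot3 x y := by
  have hy' : dot3 (-y) (-y) = 1 := by simpa [dot3] using hy
  have h := dot3_lt_one hx hy' hne
  simp only [dot3, Pi.neg_apply] at *
  linarith

theorem norm3_sub_dot3_smul {x y : Fin 3 → ℝ} (hx : dot3 x x = 1) (hy : dot3 y y = 1) :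
    norm3 (y - dot3 y x • x) = √(1 - dot3 x y ^ 2) := by
  have h : dot3 (y - dot3 y x • x) (y - dot3 y x • x)
      = dot3 y y - 2 * dot3 x y ^ 2 + dot3 x y ^ 2 * dot3 x x := by
    simp only [dot3, Pi.sub_apply, Pi.smul_apply, smul_eq_mul]; ring
  rw [norm3, h, hx, hy]
  ring_nf

/-- The component of `Yvec x y` along a vector `v` tangent to the sphere at `x`. -/
theorem dot3_Yvec_of_orthogonal {v x y : Fin 3 → ℝ} (hx : dot3 x x = 1) (hy : dot3 y y = 1)
    (hv : dot3 v x = 0) : dot3 v (Yvec x y) = (√(1 - dot3 x y ^ 2))⁻¹ * dot3 v y := by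
  rw [Yvec, norm3_sub_dot3_smul hx hy]
  generalize (√(1 - dot3 x y ^ 2))⁻¹ = c
  generalize dot3 y x = d
  simp only [dot3, Pi.sub_apply, Pi.smul_apply, smul_eq_mul] at *
  linear_combination -c * d * hv

theorem HasDerivAt.dot3 {p q : ℝ → Fin 3 → ℝ} {p' q' : Fin 3 → ℝ} {t : ℝ}
    (hp : HasDerivAt p p' t) (hq : HasDerivAt q q' t) :
    HasDerivAt (fun s => _root_.dot3 (p s) (q s))
      (_root_.dot3 p' (q t) + _root_.dot3 q' (p t)) t := by
  rw [hasDerivAt_pi] at hp hq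
  refine ((((hp 0).mul (hq 0)).add ((hp 1).mul (hq 1))).add ((hp 2).mul (hq 2))).congr_deriv ?_
  simp only [_root_.dot3]; ring

theorem dot3_deriv_self_eq_zero {p : ℝ → Fin 3 → ℝ} (hp : Differentiable ℝ p)
    (hpu : ∀ t, dot3 (p t) (p t) = 1) (t : ℝ) : dot3 (deriv p t) (p t) = 0 := by
  have h := (hp t).hasDerivAt.dot3 (hp t).hasDerivAt
  simp only [hpu] at h
  linarith [h.unique (hasDerivAt_const t 1)]

/-- For two differentiable trajectories `p`, `q` on the unit sphere with `p(t) ≠ ±q(t)`,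
`d/dt arccos(p(t)·q(t)) = −p′(t)·Y(p(t),q(t)) − q′(t)·Y(q(t),p(t))`. -/
theorem geodesic_distance_deriv_two_trajectories
    (p q : ℝ → Fin 3 → ℝ) (hp : Differentiable ℝ p) (hq : Differentiable ℝ q)
    (hpu : ∀ t, norm3 (p t) = 1) (hqu : ∀ t, norm3 (q t) = 1)
    (hne : ∀ t, p t ≠ q t) (hne' : ∀ t, p t ≠ -(q t)) :
    ∀ t, deriv (fun s => Real.arccos (dot3 (p s) (q s))) t
      = -(dot3 (deriv p t) (Yvec (p t) (q t))) - dot3 (deriv q t) (Yvec (q t) (p t)) := by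
  intro t
  have hp1 := fun t => dot3_self_eq_one_of_norm3_eq_one (hpu t)
  have hq1 := fun t => dot3_self_eq_one_of_norm3_eq_one (hqu t)
  have hd := (Real.hasDerivAt_arccos (neg_one_lt_dot3 (hp1 t) (hq1 t) (hne' t)).ne'
    (dot3_lt_one (hp1 t) (hq1 t) (hne t)).ne).comp t ((hp t).hasDerivAt.dot3 (hq t).hasDerivAt)
  refine hd.deriv.trans ?_
  rw [dot3_Yvec_of_orthogonal (hp1 t) (hq1 t) (dot3_deriv_self_eq_zero hp hp1 t),
    dot3_Yvec_of_orthogonal (hq1 t) (hp1 t) (dot3_deriv_self_eq_zero hq hq1 t),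
    dot3_comm (q t) (p t)]
  ring
end

section
/- Let I be a finite index set, n ∈ ℕ, and fix constants λ_i ∈ ℝ and unknown constant weight vectors w_i ∈ ℝⁿ for i ∈ I, and gains K > 0, Γ > 0. Let f, θ, θ_t : ℝ → ℝ and b : ℝ → ℝⁿ and ŵ_i : ℝ → ℝⁿ (i ∈ I) be differentiable functions. Define the tracking error e(t) := θ(t) − θ_t(t), the true gain B(t) := Σ_{i∈I} λ_i ⟨w_i, b(t)⟩, the estimated gain B̂(t) := Σ_{i∈I} λ_i ⟨ŵ_i(t), b(t)⟩, and assume B̂(t) ≠ 0 for all t. Define the control law ũ(t) := −(f(t) − θ_t′(t) + K·e(t))/B̂(t). Assume the dynamics θ′(t) = f(t) + B(t)·ũ(t) and estimator update laws ŵ_i′(t) = Γ·e(t)·λ_i·ũ(t)·b(t) hold for all t. Then the Lyapunov function V(t) := (1/2)·e(t)² + (1/(2Γ))·Σ_{i∈I} ‖ŵ_i(t) − w_i‖² satisfies V′(t) = −K·e(t)² for all t; in particular V is nonincreasing. -/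
open Real Filter
open scoped RealInnerProductSpace

/-- Lyapunov analysis of the adaptive turning-angle controller: under the dynamics
`θ′ = f + B·ũ` with `B(t) = Σᵢ λᵢ⟨wᵢ, b(t)⟩`, the control law
`ũ = −(f − θₜ′ + K·e)/B̂` with `B̂(t) = Σᵢ λᵢ⟨ŵᵢ(t), b(t)⟩ ≠ 0`, and the estimator
update laws `ŵᵢ′ = Γ·e·λᵢ·ũ·b`, the Lyapunov function
`V = (1/2)e² + (1/(2Γ))Σᵢ‖ŵᵢ − wᵢ‖²` satisfies `V′ = −K·e²`; in particular `V`
is nonincreasing. -/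
theorem adaptive_lyapunov_decrease
    {I : Type*} [Fintype I] {n : ℕ}
    (lam : I → ℝ) (w : I → EuclideanSpace ℝ (Fin n))
    (K Γ : ℝ) (hK : 0 < K) (hΓ : 0 < Γ)
    (f θ θt : ℝ → ℝ) (b : ℝ → EuclideanSpace ℝ (Fin n))
    (what : I → ℝ → EuclideanSpace ℝ (Fin n))
    (hf : Differentiable ℝ f) (hθ : Differentiable ℝ θ) (hθt : Differentiable ℝ θt)
    (hb : Differentiable ℝ b) (hwhat : ∀ i, Differentiable ℝ (what i))
    (e B Bhat u V : ℝ → ℝ)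
    (he : ∀ t, e t = θ t - θt t)
    (hB : ∀ t, B t = ∑ i, lam i * ⟪w i, b t⟫)
    (hBhat : ∀ t, Bhat t = ∑ i, lam i * ⟪what i t, b t⟫)
    (hBhat0 : ∀ t, Bhat t ≠ 0)
    (hu : ∀ t, u t = -(f t - deriv θt t + K * e t) / Bhat t)
    (hdyn : ∀ t, deriv θ t = f t + B t * u t)
    (hupd : ∀ i t, deriv (what i) t = (Γ * e t * lam i * u t) • b t)
    (hV : ∀ t, V t = (1 / 2) * e t ^ 2 + (1 / (2 * Γ)) * ∑ i, ‖what i t - w i‖ ^ 2) :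
    (∀ t, deriv V t = -K * e t ^ 2) ∧ Antitone V := by
  have hderiv : ∀ t, HasDerivAt V (-K * e t ^ 2) t := by
    intro t
    have he' : HasDerivAt e (f t + B t * u t - deriv θt t) t := by
      rw [funext he, ← hdyn t]
      exact (hθ t).hasDerivAt.sub (hθt t).hasDerivAt
    have hnorm : ∀ i, HasDerivAt (fun s => ‖what i s - w i‖ ^ 2)
        (2 * ⟪what i t - w i, (Γ * e t * lam i * u t) • b t⟫) t := by
      intro i
      rw [← hupd i t]
      exact ((hwhat i t).hasDerivAt.sub_const (w i)).norm_sq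
    have hV' := ((he'.pow 2).const_mul (1 / 2)).add
      ((HasDerivAt.fun_sum fun i (_ : i ∈ Finset.univ) => hnorm i).const_mul (1 / (2 * Γ)))
    have hsum : ∑ i, 2 * ⟪what i t - w i, (Γ * e t * lam i * u t) • b t⟫
        = 2 * Γ * (e t * u t * (Bhat t - B t)) := by
      rw [hBhat, hB, ← Finset.sum_sub_distrib, Finset.mul_sum, Finset.mul_sum]
      refine Finset.sum_congr rfl fun i _ => ?_
      rw [inner_smul_right, inner_sub_left]
      ring
    have hcontrol : Bhat t * u t = -(f t - deriv θt t + K * e t) := by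
      rw [hu, mul_div_cancel₀ _ (hBhat0 t)]
    rw [funext hV]
    refine hV'.congr_deriv ?_
    rw [hsum, ← mul_assoc (1 / (2 * Γ)), one_div_mul_cancel (by positivity)]
    push_cast
    linear_combination e t * hcontrol
  refine ⟨fun t => (hderiv t).deriv, ?_⟩
  refine antitone_of_deriv_nonpos (fun t => (hderiv t).differentiableAt) fun t => ?_
  rw [(hderiv t).deriv, neg_mul]
  exact neg_nonpos.mpr (by positivity)
end

section
/- Let I be a finite index set, n ∈ ℕ, constants λ_i ∈ ℝ, unknown constant weight vectors w_i ∈ ℝⁿ (i ∈ I), and gains K > 0, Γ > 0. Let f, θ, θ_t, ζ : ℝ → ℝ, ũ_a : ℝ → ℝ, b : ℝ → ℝⁿ, and ŵ_i : ℝ → ℝⁿ be differentiable functions. Define e(t) := θ(t) − θ_t(t), B(t) := Σ_{i∈I} λ_i ⟨w_i, b(t)⟩, B̂(t) := Σ_{i∈I} λ_i ⟨ŵ_i(t), b(t)⟩ with B̂(t) ≠ 0 for all t, the commanded control ũ(t) := −(f(t) − θ_t′(t) + K·e(t))/B̂(t), and the modified tracking error e_m(t) := e(t) − ζ(t). Assume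 for all t: the dynamics θ′(t) = f(t) + B(t)·ũ_a(t) under the actuated input ũ_a, the hedging dynamics ζ′(t) = −K·ζ(t) + B̂(t)·(ũ_a(t) − ũ(t)), and the modified estimator update laws ŵ_i′(t) = Γ·e_m(t)·λ_i·ũ_a(t)·b(t). Then the modified Lyapunov function V_m(t) := (1/2)·e_m(t)² + (1/(2Γ))·Σ_{i∈I} ‖ŵ_i(t) − w_i‖² satisfies V_m′(t) = −K·e_m(t)² for all t; in particular V_m is nonincreasing. -/
open Real Filter
open scoped RealInnerProductSpace

/-- Lyapunov analysis of the adaptive controller with actuator constraints (pseudo-control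
hedging): under the dynamics `θ′ = f + B·ũₐ` with `B(t) = Σᵢ λᵢ⟨wᵢ, b(t)⟩`, the commanded
control `ũ = −(f − θₜ′ + K·e)/B̂` with `B̂(t) = Σᵢ λᵢ⟨ŵᵢ(t), b(t)⟩ ≠ 0`, the hedging
dynamics `ζ′ = −K·ζ + B̂·(ũₐ − ũ)`, the modified tracking error `eₘ = e − ζ`, and the
modified estimator update laws `ŵᵢ′ = Γ·eₘ·λᵢ·ũₐ·b`, the modified Lyapunov function
`Vₘ = (1/2)eₘ² + (1/(2Γ))Σᵢ‖ŵᵢ − wᵢ‖²` satisfies `Vₘ′ = −K·eₘ²`; in particular `Vₘ`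
is nonincreasing. -/
theorem modified_adaptive_lyapunov_decrease
    {I : Type*} [Fintype I] {n : ℕ}
    (lam : I → ℝ) (w : I → EuclideanSpace ℝ (Fin n))
    (K Γ : ℝ) (hK : 0 < K) (hΓ : 0 < Γ)
    (f θ θt ζ ua : ℝ → ℝ) (b : ℝ → EuclideanSpace ℝ (Fin n))
    (what : I → ℝ → EuclideanSpace ℝ (Fin n))
    (hf : Differentiable ℝ f) (hθ : Differentiable ℝ θ) (hθt : Differentiable ℝ θt)
    (hζ : Differentiable ℝ ζ) (hua : Differentiable ℝ ua)
    (hb : Differentiable ℝ b) (hwhat : ∀ i, Differentiable ℝ (what i))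
    (e B Bhat u em Vm : ℝ → ℝ)
    (he : ∀ t, e t = θ t - θt t)
    (hB : ∀ t, B t = ∑ i, lam i * ⟪w i, b t⟫)
    (hBhat : ∀ t, Bhat t = ∑ i, lam i * ⟪what i t, b t⟫)
    (hBhat0 : ∀ t, Bhat t ≠ 0)
    (hu : ∀ t, u t = -(f t - deriv θt t + K * e t) / Bhat t)
    (hem : ∀ t, em t = e t - ζ t)
    (hdyn : ∀ t, deriv θ t = f t + B t * ua t)
    (hhedge : ∀ t, deriv ζ t = -K * ζ t + Bhat t * (ua t - u t))
    (hupd : ∀ i t, deriv (what i) t = (Γ * em t * lam i * ua t) • b t)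
    (hVm : ∀ t, Vm t = (1 / 2) * em t ^ 2 + (1 / (2 * Γ)) * ∑ i, ‖what i t - w i‖ ^ 2) :
    (∀ t, deriv Vm t = -K * em t ^ 2) ∧ Antitone Vm := by
  have hBu : ∀ t, Bhat t * u t = -(f t - deriv θt t + K * e t) := fun t => by
    rw [hu t, mul_div_cancel₀ _ (hBhat0 t)]
  have hem' : ∀ t, HasDerivAt em (-K * em t + (B t - Bhat t) * ua t) t := fun t => by
    have h := ((hθ t).hasDerivAt.sub (hθt t).hasDerivAt).sub (hζ t).hasDerivAt
    have hfun : em = θ - θt - ζ := by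
      funext s
      simp [hem, he]
    rw [← hfun] at h
    refine h.congr_deriv ?_
    rw [hdyn, hhedge, hem]
    linear_combination hBu t
  have hsum : ∀ t, HasDerivAt (fun s => ∑ i, ‖what i s - w i‖ ^ 2)
      (2 * Γ * em t * ua t * (Bhat t - B t)) t := fun t => by
    have h := HasDerivAt.fun_sum (u := Finset.univ) fun i _ =>
      ((hwhat i t).hasDerivAt.sub_const (w i)).norm_sq
    refine h.congr_deriv ?_
    rw [hBhat, hB, ← Finset.sum_sub_distrib, Finset.mul_sum]
    refine Finset.sum_congr rfl fun i _ => ?_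
    rw [hupd, real_inner_smul_right, inner_sub_left]
    ring
  have hV : ∀ t, HasDerivAt Vm (-K * em t ^ 2) t := fun t => by
    rw [funext hVm]
    refine ((((hem' t).pow 2).const_mul (1 / 2)).add
      ((hsum t).const_mul (1 / (2 * Γ)))).congr_deriv ?_
    field_simp
    ring
  refine ⟨fun t => (hV t).deriv, antitone_of_deriv_nonpos (fun t => (hV t).differentiableAt)
    fun t => ?_⟩
  rw [(hV t).deriv]
  nlinarith [mul_nonneg hK.le (sq_nonneg (em t))]
end

section
/- Let I be a finite index set, n ∈ ℕ, constants λ_i ∈ ℝ, unknown constant weight vectors w_i ∈ ℝⁿ, gains K > 0, Γ > 0, and a bound M > 0. Let f, θ, θ_t : ℝ → ℝ, b : ℝ → ℝⁿ, ŵ_i : ℝ → ℝⁿ be differentiable, define e(t) := θ(t) − θ_t(t), B(t) := Σ_{i∈I} λ_i ⟨w_i, b(t)⟩, B̂(t) := Σ_{i∈I} λ_i ⟨ŵ_i(t), b(t)⟩ ≠ 0, ũ(t) := −(f(t) − θ_t′(t) + K·e(t))/B̂(t), and assume for all t ≥ 0: θ′(t) = f(t) + B(t)·ũ(t), ŵ_i′(t)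 = Γ·e(t)·λ_i·ũ(t)·b(t), |θ′(t)| ≤ M, |θ_t′(t)| ≤ M, and |e(t)| ≤ M. Then the turning angle converges to the target: e(t) = θ(t) − θ_t(t) → 0 as t → ∞. -/
open Real Filter
open scoped RealInnerProductSpace

/-- A Barbalat-type lemma: if a nonnegative function `V` satisfies `V′ = -K·e²` on `[0, ∞)` and `e`
is Lipschitz there, then `e` tends to `0`. -/
theorem tendsto_zero_of_hasDerivAt_neg_mul_sq {V e : ℝ → ℝ} {K L : ℝ} (hK : 0 < K) (hL : 0 < L)
    (hV0 : ∀ t, 0 ≤ t → 0 ≤ V t) (hV : ∀ t, 0 ≤ t → HasDerivAt V (-(K * e t ^ 2)) t)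
    (he : ∀ s t, 0 ≤ s → s ≤ t → |e t - e s| ≤ L * (t - s)) :
    Tendsto e atTop (nhds 0) := by
  have decr : ∀ s t c : ℝ, 0 ≤ s → s ≤ t → (∀ r ∈ Set.Icc s t, c ≤ K * e r ^ 2) →
      V t - V s ≤ -c * (t - s) := by
    intro s t c hs hst hc
    refine (convex_Icc s t).image_sub_le_mul_sub_of_deriv_le
      (fun r hr => (hV r (hs.trans hr.1)).continuousAt.continuousWithinAt)
      (fun r hr => ?_) (fun r hr => ?_) s ⟨le_rfl, hst⟩ t ⟨hst, le_rfl⟩ hst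
    · have hr' := interior_subset hr
      exact (hV r (hs.trans hr'.1)).differentiableAt.differentiableWithinAt
    · have hr' := interior_subset hr
      rw [(hV r (hs.trans hr'.1)).deriv]
      linarith [hc r hr']
  have hanti : Antitone fun t => V (max 0 t) := by
    intro s t hst
    have := decr (max 0 s) (max 0 t) 0 (le_max_left _ _) (max_le_max le_rfl hst)
      (fun r _ => by positivity)
    simp only
    linarith
  have hbdd : BddBelow (Set.range fun t => V (max 0 t)) :=
    ⟨0, by rintro _ ⟨t, rfl⟩; exact hV0 _ (le_max_left _ _)⟩
  have hlim := tendsto_atTop_ciInf hanti hbdd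
  rw [Metric.tendsto_atTop]
  intro ε hε
  set δ := ε / (2 * L) with hδ
  have hδ0 : 0 < δ := by positivity
  have hLδ : L * δ = ε / 2 := by rw [hδ]; field_simp
  have hdiff := hlim.sub (hlim.comp (tendsto_atTop_add_const_right atTop δ tendsto_id))
  rw [sub_self] at hdiff
  have hc : 0 < K * (ε / 2) ^ 2 * δ := by positivity
  obtain ⟨N, hN⟩ := eventually_atTop.1 (hdiff.eventually_lt_const hc)
  refine ⟨max 0 N, fun t ht => ?_⟩
  have ht0 : 0 ≤ t := (le_max_left _ _).trans ht
  have hlt := hN t ((le_max_right _ _).trans ht)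
  simp only [Function.comp_apply, id, max_eq_right ht0,
    max_eq_right (add_nonneg ht0 hδ0.le)] at hlt
  rw [Real.dist_eq, sub_zero]
  by_contra! hge
  have := decr t (t + δ) (K * (ε / 2) ^ 2) ht0 (by linarith) (fun r hr => by
    have h1 := he t r ht0 hr.1
    have h2 : L * (r - t) ≤ L * δ := by gcongr; linarith [hr.2]
    have h3 : |e t| ≤ |e r| + |e r - e t| := by
      have := abs_sub_abs_le_abs_sub (e t) (e r)
      rw [abs_sub_comm] at this
      linarith
    have h4 : ε / 2 ≤ |e r| := by linarith
    rw [← sq_abs (e r)]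
    gcongr)
  linarith

/-- Convergence of the adaptive turning-angle tracking controller: under the dynamics
`θ′ = f + B·ũ` with `B(t) = Σᵢ λᵢ⟨wᵢ, b(t)⟩`, the control law `ũ = −(f − θₜ′ + K·e)/B̂`
with `B̂(t) = Σᵢ λᵢ⟨ŵᵢ(t), b(t)⟩ ≠ 0`, the estimator update laws `ŵᵢ′ = Γ·e·λᵢ·ũ·b`,
and the boundedness assumptions `|θ′(t)| ≤ M`, `|θₜ′(t)| ≤ M`, `|e(t)| ≤ M` for `t ≥ 0`,
the tracking error converges: `θ(t) − θₜ(t) → 0` as `t → ∞`. -/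
theorem adaptive_tracking_convergence
    {I : Type*} [Fintype I] {n : ℕ}
    (lam : I → ℝ) (w : I → EuclideanSpace ℝ (Fin n))
    (K Γ M : ℝ) (hK : 0 < K) (hΓ : 0 < Γ) (hM : 0 < M)
    (f θ θt : ℝ → ℝ) (b : ℝ → EuclideanSpace ℝ (Fin n))
    (what : I → ℝ → EuclideanSpace ℝ (Fin n))
    (hf : Differentiable ℝ f) (hθ : Differentiable ℝ θ) (hθt : Differentiable ℝ θt)
    (hb : Differentiable ℝ b) (hwhat : ∀ i, Differentiable ℝ (what i))
    (e B Bhat u : ℝ → ℝ)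
    (he : ∀ t, e t = θ t - θt t)
    (hB : ∀ t, B t = ∑ i, lam i * ⟪w i, b t⟫)
    (hBhat : ∀ t, Bhat t = ∑ i, lam i * ⟪what i t, b t⟫)
    (hBhat0 : ∀ t, Bhat t ≠ 0)
    (hu : ∀ t, u t = -(f t - deriv θt t + K * e t) / Bhat t)
    (hdyn : ∀ t, 0 ≤ t → deriv θ t = f t + B t * u t)
    (hupd : ∀ i t, 0 ≤ t → deriv (what i) t = (Γ * e t * lam i * u t) • b t)
    (hθbound : ∀ t, 0 ≤ t → |deriv θ t| ≤ M)
    (hθtbound : ∀ t, 0 ≤ t → |deriv θt t| ≤ M)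
    (hebound : ∀ t, 0 ≤ t → |e t| ≤ M) :
    Tendsto (fun t => θ t - θt t) atTop (nhds 0) := by
  have hee : e = fun t => θ t - θt t := funext he
  rw [← hee]
  have hed : ∀ t, HasDerivAt e (deriv θ t - deriv θt t) t := fun t => by
    rw [hee]; exact (hθ t).hasDerivAt.sub (hθt t).hasDerivAt
  refine tendsto_zero_of_hasDerivAt_neg_mul_sq
    (V := fun t => e t ^ 2 / 2 + (∑ i, ‖what i t - w i‖ ^ 2) / (2 * Γ)) (L := 2 * M) hK
    (by positivity) (fun t _ => by positivity) (fun t ht => ?_) (fun s t hs hst => ?_)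
  · have hsum : HasDerivAt (fun t => ∑ i, ‖what i t - w i‖ ^ 2)
        (∑ i, 2 * ⟪what i t - w i, (Γ * e t * lam i * u t) • b t⟫) t := by
      refine HasDerivAt.fun_sum fun i _ => ?_
      rw [← hupd i t ht]
      exact ((hwhat i t).hasDerivAt.sub_const (w i)).norm_sq
    have hsum_eq : ∑ i, 2 * ⟪what i t - w i, (Γ * e t * lam i * u t) • b t⟫
        = 2 * Γ * e t * u t * (Bhat t - B t) := by
      rw [hB, hBhat, ← Finset.sum_sub_distrib, Finset.mul_sum]
      refine Finset.sum_congr rfl fun i _ => ?_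
      rw [real_inner_smul_right, inner_sub_left]
      ring
    have hctrl : u t * Bhat t = -(f t - deriv θt t + K * e t) := by
      rw [hu, div_mul_cancel₀ _ (hBhat0 t)]
    rw [hsum_eq] at hsum
    refine ((((hed t).pow 2).div_const 2).add (hsum.div_const (2 * Γ))).congr_deriv ?_
    rw [hdyn t ht]
    field_simp
    push_cast
    linear_combination 2 * e t * hctrl
  · have := (convex_Icc s t).norm_image_sub_le_of_norm_hasDerivWithin_le (C := 2 * M)
      (fun r _ => (hed r).hasDerivWithinAt)
      (fun r hr => by
        have hr0 : 0 ≤ r := hs.trans hr.1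
        rw [Real.norm_eq_abs]
        linarith [abs_sub (deriv θ r) (deriv θt r), hθbound r hr0, hθtbound r hr0])
      (Set.left_mem_Icc.2 hst) (Set.right_mem_Icc.2 hst)
    rwa [Real.norm_eq_abs, Real.norm_eq_abs, abs_of_nonneg (sub_nonneg.2 hst)] at this
end

section
/- Under the modified adaptive scheme (dynamics θ′ = f + B·ũ_a with B(t) = Σ_i λ_i ⟨w_i, b(t)⟩, hedging ζ′ = −Kζ + B̂·(ũ_a − ũ), modified error e_m := θ − θ_t − ζ, update laws ŵ_i′(t) = Γ·e_m(t)·λ_i·ũ_a(t)·b(t), with K, Γ > 0, B̂(t) ≠ 0, all functions differentiable), define V_m(t) := (1/2)·e_m(t)² + (1/(2Γ))·Σ_{i∈I} ‖ŵ_i(t) − w_i‖². Then for every i ∈ I and every t, the estimation error satisfies ‖ŵ_i(t) − w_i‖ ≤ √(2Γ·V_m(t)), and for all t₁ ≤ t₂ one has V_m(t₂) ≤ V_m(t₁); consequently ‖ŵ_i(t₂) − w_i‖ ≤ √(2Γ·V_m(t₁)) for all t₂ ≥ t₁, i.e. the estimator errors are bounded by a bound that does not increase in time. -/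
open Real Filter
open scoped RealInnerProductSpace

/-- Boundedness of the estimation errors under the modified adaptive scheme: with the
dynamics `θ′ = f + B·ũₐ`, commanded control `ũ = −(f − θₜ′ + K·e)/B̂`, hedging dynamics
`ζ′ = −K·ζ + B̂·(ũₐ − ũ)`, modified tracking error `eₘ = e − ζ`, and modified update laws
`ŵᵢ′ = Γ·eₘ·λᵢ·ũₐ·b`, the modified Lyapunov function
`Vₘ = (1/2)eₘ² + (1/(2Γ))Σᵢ‖ŵᵢ − wᵢ‖²` dominates the estimation errors,
`‖ŵᵢ(t) − wᵢ‖ ≤ √(2Γ·Vₘ(t))`, and is nonincreasing; consequently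
`‖ŵᵢ(t₂) − wᵢ‖ ≤ √(2Γ·Vₘ(t₁))` for all `t₂ ≥ t₁`. -/
theorem modified_adaptive_estimator_errors_bounded
    {I : Type*} [Fintype I] {n : ℕ}
    (lam : I → ℝ) (w : I → EuclideanSpace ℝ (Fin n))
    (K Γ : ℝ) (hK : 0 < K) (hΓ : 0 < Γ)
    (f θ θt ζ ua : ℝ → ℝ) (b : ℝ → EuclideanSpace ℝ (Fin n))
    (what : I → ℝ → EuclideanSpace ℝ (Fin n))
    (hf : Differentiable ℝ f) (hθ : Differentiable ℝ θ) (hθt : Differentiable ℝ θt)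
    (hζ : Differentiable ℝ ζ) (hua : Differentiable ℝ ua)
    (hb : Differentiable ℝ b) (hwhat : ∀ i, Differentiable ℝ (what i))
    (e B Bhat u em Vm : ℝ → ℝ)
    (he : ∀ t, e t = θ t - θt t)
    (hB : ∀ t, B t = ∑ i, lam i * ⟪w i, b t⟫)
    (hBhat : ∀ t, Bhat t = ∑ i, lam i * ⟪what i t, b t⟫)
    (hBhat0 : ∀ t, Bhat t ≠ 0)
    (hu : ∀ t, u t = -(f t - deriv θt t + K * e t) / Bhat t)
    (hem : ∀ t, em t = e t - ζ t)
    (hdyn : ∀ t, deriv θ t = f t + B t * ua t)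
    (hhedge : ∀ t, deriv ζ t = -K * ζ t + Bhat t * (ua t - u t))
    (hupd : ∀ i t, deriv (what i) t = (Γ * em t * lam i * ua t) • b t)
    (hVm : ∀ t, Vm t = (1 / 2) * em t ^ 2 + (1 / (2 * Γ)) * ∑ i, ‖what i t - w i‖ ^ 2) :
    (∀ i t, ‖what i t - w i‖ ≤ Real.sqrt (2 * Γ * Vm t)) ∧
    (∀ t₁ t₂, t₁ ≤ t₂ → Vm t₂ ≤ Vm t₁) ∧
    (∀ i t₁ t₂, t₁ ≤ t₂ → ‖what i t₂ - w i‖ ≤ Real.sqrt (2 * Γ * Vm t₁)) := by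
  have em_deriv : ∀ t, HasDerivAt em (-K * em t - (Bhat t - B t) * ua t) t := by
    intro t
    have hcancel : Bhat t * u t = -(f t - deriv θt t + K * e t) := by
      rw [hu, mul_div_cancel₀ _ (hBhat0 t)]
    have h := ((hθ t).hasDerivAt.sub (hθt t).hasDerivAt).sub (hζ t).hasDerivAt
    rw [hdyn, hhedge] at h
    have hfun : em = θ - θt - ζ := funext fun s => by simp [hem, he]
    rw [← hfun] at h
    refine h.congr_deriv ?_
    rw [hem]
    linear_combination hcancel
  have Vm_deriv : ∀ t, HasDerivAt Vm (-K * em t ^ 2) t := by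
    intro t
    have hsum : HasDerivAt (fun s => ∑ i, ‖what i s - w i‖ ^ 2)
        (∑ i, 2 * ⟪what i t - w i, (Γ * em t * lam i * ua t) • b t⟫) t := by
      refine HasDerivAt.fun_sum fun i _ => ?_
      have hi := (hwhat i t).hasDerivAt
      rw [hupd] at hi
      exact (hi.sub_const (w i)).norm_sq
    have hinner : ∑ i, 2 * ⟪what i t - w i, (Γ * em t * lam i * ua t) • b t⟫
        = 2 * Γ * em t * ua t * (Bhat t - B t) := by
      rw [hBhat, hB, ← Finset.sum_sub_distrib, Finset.mul_sum]
      refine Finset.sum_congr rfl fun i _ => ?_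
      rw [inner_smul_right, inner_sub_left]
      ring
    rw [hinner] at hsum
    rw [funext hVm]
    refine ((((em_deriv t).fun_pow 2).const_mul (1 / 2)).fun_add
      (hsum.const_mul (1 / (2 * Γ)))).congr_deriv ?_
    field_simp
    ring
  have Vm_antitone : Antitone Vm := by
    refine antitone_of_deriv_nonpos (fun t => (Vm_deriv t).differentiableAt) fun t => ?_
    rw [(Vm_deriv t).deriv]
    nlinarith [mul_nonneg hK.le (sq_nonneg (em t))]
  have error_le : ∀ i t, ‖what i t - w i‖ ≤ Real.sqrt (2 * Γ * Vm t) := by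
    intro i t
    apply Real.le_sqrt_of_sq_le
    have hsingle : ‖what i t - w i‖ ^ 2 ≤ ∑ j, ‖what j t - w j‖ ^ 2 :=
      Finset.single_le_sum (f := fun j => ‖what j t - w j‖ ^ 2)
        (fun j _ => sq_nonneg _) (Finset.mem_univ i)
    have hV : 2 * Γ * Vm t = Γ * em t ^ 2 + ∑ j, ‖what j t - w j‖ ^ 2 := by
      rw [hVm]
      field_simp
    rw [hV]
    nlinarith [mul_nonneg hΓ.le (sq_nonneg (em t))]
  refine ⟨error_le, fun _ _ h => Vm_antitone h, fun i t₁ t₂ h => (error_le i t₂).trans ?_⟩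
  exact Real.sqrt_le_sqrt (mul_le_mul_of_nonneg_left (Vm_antitone h) (by positivity))
end

section
/- Let A, c ∈ ℝ and L > 0. Define the turning angle θ(s) := A·(cos(2πs/L) − 1) + c and the plane curve γ : ℝ → ℝ² by γ(s) := (∫₀ˢ cos(θ(τ)) dτ, ∫₀ˢ sin(θ(τ)) dτ). Then γ is L-periodic in the sense that γ(s + L) = γ(s) for all s ∈ ℝ if and only if ∫₀^{2π} cos(A·cos u) du = 0 (i.e. if and only if A is a root of the Bessel function J₀ of the first kind of order zero, since ∫₀^{2π} cos(A·cos u) du = 2π·J₀(A)). -/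
open Real

/-- A function that changes sign under translation by `T` has vanishing integral over
`[0, 2 * T]`. -/
theorem Function.Antiperiodic.intervalIntegral_two_mul_eq_zero {f : ℝ → ℝ} {T : ℝ}
    (hf : Function.Antiperiodic f T) : ∫ u in (0:ℝ)..(2 * T), f u = 0 := by
  have hper : Function.Periodic f (2 * T) := hf.periodic_two_mul
  have hshift := hper.intervalIntegral_add_eq 0 T
  have hneg : ∫ u in (0:ℝ)..(2 * T), f (u + T) = -∫ u in (0:ℝ)..(2 * T), f u := by
    rw [← intervalIntegral.integral_neg]
    exact intervalIntegral.integral_congr fun u _ => hf u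
  rw [intervalIntegral.integral_comp_add_right, zero_add, add_comm (2 * T) T] at hneg
  rw [zero_add] at hshift
  linarith

theorem integral_sin_mul_cos_eq_zero (A : ℝ) :
    ∫ u in (0:ℝ)..(2 * π), sin (A * cos u) = 0 :=
  Function.Antiperiodic.intervalIntegral_two_mul_eq_zero fun u => by simp [cos_add_pi]

theorem integral_cos_mul_cos_add (A d : ℝ) :
    ∫ u in (0:ℝ)..(2 * π), cos (A * cos u + d) =
      cos d * ∫ u in (0:ℝ)..(2 * π), cos (A * cos u) := by
  simp only [cos_add]
  rw [intervalIntegral.integral_sub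
    (Continuous.intervalIntegrable (by fun_prop) _ _)
    (Continuous.intervalIntegrable (by fun_prop) _ _), intervalIntegral.integral_mul_const,
    intervalIntegral.integral_mul_const, integral_sin_mul_cos_eq_zero]
  ring

theorem integral_sin_mul_cos_add (A d : ℝ) :
    ∫ u in (0:ℝ)..(2 * π), sin (A * cos u + d) =
      sin d * ∫ u in (0:ℝ)..(2 * π), cos (A * cos u) := by
  simp only [sin_add]
  rw [intervalIntegral.integral_add
    (Continuous.intervalIntegrable (by fun_prop) _ _)
    (Continuous.intervalIntegrable (by fun_prop) _ _), intervalIntegral.integral_mul_const,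
    intervalIntegral.integral_mul_const, integral_sin_mul_cos_eq_zero]
  ring

/-- For a continuous `2π`-periodic `g`, the increment over one period of the primitive of
`g (2 * π * τ / L)` is a rescaled integral of `g` over `[0, 2 * π]`. -/
theorem integral_comp_rescale_add_period {g : ℝ → ℝ} (hg : Continuous g)
    (hper : Function.Periodic g (2 * π)) {L : ℝ} (hL : L ≠ 0) (s : ℝ) :
    ∫ τ in (0:ℝ)..(s + L), g (2 * π * τ / L) =
      (∫ τ in (0:ℝ)..s, g (2 * π * τ / L)) + L / (2 * π) * ∫ u in (0:ℝ)..(2 * π), g u := by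
  have hint : ∀ a b : ℝ, IntervalIntegrable (fun τ => g (2 * π * τ / L)) MeasureTheory.volume a b :=
    fun a b => Continuous.intervalIntegrable (by fun_prop) a b
  have hperL : Function.Periodic (fun τ => g (2 * π * τ / L)) L := fun τ => by
    have : 2 * π * (τ + L) / L = 2 * π * τ / L + 2 * π := by field_simp
    simp only [this, hper _]
  rw [← intervalIntegral.integral_add_adjacent_intervals (hint 0 s) (hint s (s + L)),
    hperL.intervalIntegral_add_eq s 0, zero_add]
  congr 1
  have hc : 2 * π / L ≠ 0 := div_ne_zero two_pi_pos.ne' hL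
  have hrw : ∀ τ : ℝ, 2 * π * τ / L = 2 * π / L * τ := fun τ => by ring
  simp only [hrw]
  rw [intervalIntegral.integral_comp_mul_left g hc, mul_zero, div_mul_cancel₀ _ hL, inv_div,
    smul_eq_mul]



/-- A unit-speed plane curve reconstructed from the turning angle
`θ(s) = A·(cos(2πs/L) − 1) + c` is `L`-periodic if and only if
`∫₀^{2π} cos(A·cos u) du = 0`, i.e. if and only if `A` is a root of the zeroth-order
Bessel function of the first kind (via its integral representation
`J₀(A) = (1/2π)·∫₀^{2π} cos(A·cos u) du`). -/
theorem figure_eight_periodic_iff_bessel_root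
    (A c L : ℝ) (hL : 0 < L)
    (θ : ℝ → ℝ) (hθ : ∀ s, θ s = A * (Real.cos (2 * π * s / L) - 1) + c)
    (γ : ℝ → ℝ × ℝ)
    (hγ : ∀ s, γ s = (∫ τ in (0:ℝ)..s, Real.cos (θ τ), ∫ τ in (0:ℝ)..s, Real.sin (θ τ))) :
    (∀ s, γ (s + L) = γ s) ↔ (∫ u in (0:ℝ)..(2 * π), Real.cos (A * Real.cos u)) = 0 := by
  have hθ' : ∀ s, θ s = A * cos (2 * π * s / L) + (c - A) := fun s => by rw [hθ]; ring
  have hx := fun s => integral_comp_rescale_add_period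
    (g := fun u => cos (A * cos u + (c - A))) (by fun_prop) (fun u => by simp) hL.ne' s
  have hy := fun s => integral_comp_rescale_add_period
    (g := fun u => sin (A * cos u + (c - A))) (by fun_prop) (fun u => by simp) hL.ne' s
  have hk : L / (2 * π) ≠ 0 := div_ne_zero hL.ne' two_pi_pos.ne'
  simp only [hγ, hθ', Prod.mk.injEq, hx, hy, integral_cos_mul_cos_add, integral_sin_mul_cos_add,
    add_eq_left, mul_eq_zero, hk, false_or, forall_const]
  constructor
  · rintro ⟨hcos | hJ, hsin | hJ'⟩
    · have := sin_sq_add_cos_sq (c - A)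
      simp [hcos, hsin] at this
    all_goals assumption
  · exact fun hJ => ⟨Or.inr hJ, Or.inr hJ⟩
end
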